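/- There exist constants c, C > 0 and N₀ ∈ ℕ such that for every integer N ≥ N₀, the high-pass filter of Riemann's non-differentiable function satisfies c · N^{-3} · log N ≤ ‖R_{≥N}‖_{L⁴(𝕋)}⁴ ≤ C · N^{-3} · log N. -/

import Mathlib

open Real MeasureTheory

/-- `σ k = 1` if `k` is a perfect square, `0` otherwise. -/
noncomputable def sqIndicator (k : ℕ) : ℝ := if IsSquare k then 1 else 0

/-- The character `e_k(x) = e^{2πikx}`. -/
noncomputable def eChar (k : ℕ) (x : ℝ) : ℂ :=
  Complex.exp (2 * Real.pi * Complex.I * (k : ℂ) * (x : ℂ))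

/-- Riemann's non-differentiable function `R(x) = ∑_{k≥1} (σ_k/k) e^{2πikx}
    = ∑_{n≥1} e^{2πin²x}/n²`. -/
noncomputable def RiemannF (x : ℝ) : ℂ :=
  ∑' k : ℕ, ((sqIndicator k / k : ℝ) : ℂ) * eChar k x

/-- High-pass filter `R_{≥N}(x) = ∑_{k ≥ N} (σ_k/k) e^{2πikx}`. -/
noncomputable def RiemannHigh (N : ℕ) (x : ℝ) : ℂ :=
  ∑' k : ℕ, if N ≤ k then ((sqIndicator k / k : ℝ) : ℂ) * eChar k x else 0

/-- The quadruples `(a, b, c, d)` of elements of `S` with `a² + b² = c² + d²`. -/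
def squareQuadruples (S : Finset ℕ) : Finset (ℕ × ℕ × ℕ × ℕ) :=
  {p ∈ S ×ˢ S ×ˢ S ×ˢ S | p.1 ^ 2 + p.2.1 ^ 2 = p.2.2.1 ^ 2 + p.2.2.2 ^ 2}

lemma mem_squareQuadruples {S : Finset ℕ} {a b c d : ℕ} :
    (a, b, c, d) ∈ squareQuadruples S ↔
      (a ∈ S ∧ b ∈ S ∧ c ∈ S ∧ d ∈ S) ∧ a ^ 2 + b ^ 2 = c ^ 2 + d ^ 2 := by
  simp [squareQuadruples]

lemma sum_Icc_inv_sq_le_two (V : ℕ) : ∑ e ∈ Finset.Icc 1 V, ((e : ℝ) ^ 2)⁻¹ ≤ 2 := by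
  have h := sum_Ioo_inv_sq_le (α := ℝ) 0 (V + 1)
  have h' : Finset.Ioo 0 (V + 1) = Finset.Icc 1 V := by
    ext; simp; omega
  rw [h'] at h
  simpa using h

lemma sum_multiples_inv_sq_le {d : ℕ} (hd : 1 ≤ d) (V : ℕ) :
    ∑ n ∈ Finset.Icc 1 V with d ∣ n, ((n : ℝ) ^ 2)⁻¹ ≤ 2 * ((d : ℝ) ^ 2)⁻¹ := by
  have hsub : {n ∈ Finset.Icc 1 V | d ∣ n} ⊆ (Finset.Icc 1 V).image (d * ·) := by
    intro n hn
    simp only [Finset.mem_filter, Finset.mem_Icc] at hn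
    obtain ⟨⟨h1, h2⟩, e, rfl⟩ := hn
    refine Finset.mem_image.2 ⟨e, Finset.mem_Icc.2 ⟨?_, ?_⟩, rfl⟩
    · exact Nat.pos_of_mul_pos_left h1
    · nlinarith
  calc ∑ n ∈ Finset.Icc 1 V with d ∣ n, ((n : ℝ) ^ 2)⁻¹
      ≤ ∑ n ∈ (Finset.Icc 1 V).image (d * ·), ((n : ℝ) ^ 2)⁻¹ :=
        Finset.sum_le_sum_of_subset_of_nonneg hsub fun _ _ _ => by positivity
    _ = ∑ e ∈ Finset.Icc 1 V, (((d * e : ℕ) : ℝ) ^ 2)⁻¹ := by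
        rw [Finset.sum_image]
        intro x _ y _ hxy
        exact Nat.eq_of_mul_eq_mul_left hd hxy
    _ = (∑ e ∈ Finset.Icc 1 V, ((e : ℝ) ^ 2)⁻¹) * ((d : ℝ) ^ 2)⁻¹ := by
        rw [Finset.sum_mul]
        refine Finset.sum_congr rfl fun e _ => ?_
        push_cast
        rw [mul_pow, mul_inv, mul_comm]
    _ ≤ _ := by gcongr; exact sum_Icc_inv_sq_le_two V

lemma log_le_two_mul_sum_totient_div_sq (V : ℕ) :
    Real.log V ≤ 2 * ∑ v ∈ Finset.Icc 1 V, (v.totient : ℝ) / (v : ℝ) ^ 2 := by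
  have hlog : Real.log V ≤ ∑ n ∈ Finset.Icc 1 V, ((n : ℝ))⁻¹ := by
    have h := log_le_harmonic_floor (V : ℝ) (by positivity)
    rw [Nat.floor_natCast, harmonic_eq_sum_Icc] at h
    simpa using h
  have hexp : ∀ n ∈ Finset.Icc 1 V, ((n : ℝ))⁻¹ =
      ∑ d ∈ Finset.Icc 1 V, if d ∣ n then (d.totient : ℝ) * ((n : ℝ) ^ 2)⁻¹ else 0 := by
    intro n hn
    rw [Finset.mem_Icc] at hn
    have hn0 : (n : ℝ) ≠ 0 := by have := hn.1; positivity
    have hdiv : n.divisors = {d ∈ Finset.Icc 1 V | d ∣ n} := by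
      ext d
      simp only [Nat.mem_divisors, Finset.mem_filter, Finset.mem_Icc]
      constructor
      · rintro ⟨h1, h2⟩
        exact ⟨⟨Nat.pos_of_dvd_of_pos h1 hn.1, (Nat.le_of_dvd hn.1 h1).trans hn.2⟩, h1⟩
      · rintro ⟨_, h⟩
        exact ⟨h, by omega⟩
    rw [← Finset.sum_filter, ← hdiv, ← Finset.sum_mul, ← Nat.cast_sum, Nat.sum_totient]
    field_simp
  calc Real.log V ≤ ∑ n ∈ Finset.Icc 1 V, ((n : ℝ))⁻¹ := hlog
    _ = ∑ n ∈ Finset.Icc 1 V, ∑ d ∈ Finset.Icc 1 V,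
          if d ∣ n then (d.totient : ℝ) * ((n : ℝ) ^ 2)⁻¹ else 0 := Finset.sum_congr rfl hexp
    _ = ∑ d ∈ Finset.Icc 1 V, (d.totient : ℝ) *
          ∑ n ∈ Finset.Icc 1 V with d ∣ n, ((n : ℝ) ^ 2)⁻¹ := by
        rw [Finset.sum_comm]
        refine Finset.sum_congr rfl fun d _ => ?_
        rw [Finset.mul_sum, Finset.sum_filter]
    _ ≤ ∑ d ∈ Finset.Icc 1 V, (d.totient : ℝ) * (2 * ((d : ℝ) ^ 2)⁻¹) := by
        refine Finset.sum_le_sum fun d hd => ?_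
        gcongr
        exact sum_multiples_inv_sq_le (Finset.mem_Icc.1 hd).1 V
    _ = _ := by
        rw [Finset.mul_sum]
        refine Finset.sum_congr rfl fun d _ => ?_
        ring

/-- Parameters `(v, w, u, z)` with `v`, `w` coprime, producing distinct square quadruples. -/
def quadrupleParams (M : ℕ) : Finset (Σ _ : ℕ, ℕ × ℕ × ℕ) :=
  (Finset.Icc 1 M).sigma fun v =>
    {w ∈ Finset.Ico v (v + v) | v.Coprime w} ×ˢ
      (Finset.Icc 1 (M / v + 1) ×ˢ Finset.Icc (3 * (M / v + 1)) (4 * (M / v + 1)))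

lemma card_quadrupleParams_le (M : ℕ) :
    (quadrupleParams M).card ≤ (squareQuadruples (Finset.Ico M (18 * M))).card := by
  have key : ∀ v w u z, (⟨v, w, u, z⟩ : Σ _ : ℕ, ℕ × ℕ × ℕ) ∈ quadrupleParams M →
      0 < v ∧ v.Coprime w ∧ 0 < u ∧
      u * w + M ≤ v * z ∧ u * v + M ≤ w * z ∧ u * v + w * z < 18 * M ∧
      u * w + v * z < 18 * M := by
    intro v w u z h
    simp only [quadrupleParams, Finset.mem_sigma, Finset.mem_Icc, Finset.mem_product,
      Finset.mem_filter, Finset.mem_Ico] at h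
    obtain ⟨⟨hv, hvM⟩, ⟨⟨hvw, hwv⟩, hco⟩, ⟨hu, huq⟩, hzq, hzq'⟩ := h
    have hq1 : M < v * (M / v + 1) := Nat.lt_mul_div_succ M hv
    have hq2 : v * (M / v + 1) ≤ 2 * M := by
      have := Nat.mul_div_le M v
      nlinarith
    generalize M / v + 1 = q at *
    have hwv' : w ≤ 2 * v := by omega
    have e1 : v * u ≤ v * q := Nat.mul_le_mul_left _ huq
    have e2 : v * (3 * q) ≤ v * z := Nat.mul_le_mul_left _ hzq
    have e3 : v * z ≤ w * z := Nat.mul_le_mul_right _ hvw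
    have e4 : u * w ≤ u * (2 * v) := Nat.mul_le_mul_left _ hwv'
    have e5 : v * z ≤ v * (4 * q) := Nat.mul_le_mul_left _ hzq'
    have e6 : (w + 1) * z ≤ (2 * v) * z := Nat.mul_le_mul_right _ (by omega)
    have hz : 0 < z := by
      rcases Nat.eq_zero_or_pos z with h | h
      · omega
      · exact h
    refine ⟨hv, hco, hu, ?_, ?_, ?_, ?_⟩ <;> nlinarith
  refine Finset.card_le_card_of_injOn
    (fun p => (p.2.2.1 * p.1 + p.2.1 * p.2.2.2, p.1 * p.2.2.2 - p.2.2.1 * p.2.1,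
      p.2.1 * p.2.2.2 - p.2.2.1 * p.1, p.2.2.1 * p.2.1 + p.1 * p.2.2.2)) ?_ ?_
  · rintro ⟨v, w, u, z⟩ hp
    obtain ⟨hv, hco, hu, h1, h2, h3, h4⟩ := key v w u z hp
    simp only [Finset.mem_coe, mem_squareQuadruples, Finset.mem_Ico]
    refine ⟨by omega, ?_⟩
    zify [show u * w ≤ v * z by omega, show u * v ≤ w * z by omega]
    ring
  · rintro ⟨v, w, u, z⟩ hp ⟨v', w', u', z'⟩ hp' heq
    obtain ⟨hv, hco, hu, h1, h2, h3, h4⟩ := key v w u z hp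
    obtain ⟨hv', hco', hu', h1', h2', h3', h4'⟩ := key v' w' u' z' hp'
    simp only [Prod.mk.injEq] at heq
    obtain ⟨q1, q2, q3, q4⟩ := heq
    have a1 : u * v = u' * v' := by omega
    have a2 : u * w = u' * w' := by omega
    have a3 : v * z = v' * z' := by omega
    have hu_eq : u = u' := by
      have g : Nat.gcd (u * v) (u * w) = u := by rw [Nat.gcd_mul_left, hco, mul_one]
      have g' : Nat.gcd (u' * v') (u' * w') = u' := by rw [Nat.gcd_mul_left, hco', mul_one]
      rw [← g, ← g', a1, a2]
    subst hu_eq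
    obtain rfl := Nat.eq_of_mul_eq_mul_left hu a1
    obtain rfl := Nat.eq_of_mul_eq_mul_left hu a2
    obtain rfl := Nat.eq_of_mul_eq_mul_left hv a3
    rfl

lemma sq_mul_log_le_card_squareQuadruples (M : ℕ) :
    (M : ℝ) ^ 2 * Real.log M ≤ 2 * (squareQuadruples (Finset.Ico M (18 * M))).card := by
  have hcard : (M : ℝ) ^ 2 * ∑ v ∈ Finset.Icc 1 M, (v.totient : ℝ) / (v : ℝ) ^ 2 ≤
      (quadrupleParams M).card := by
    rw [quadrupleParams, Finset.card_sigma, Finset.mul_sum, Nat.cast_sum]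
    refine Finset.sum_le_sum fun v hv => ?_
    have hv1 : 0 < v := (Finset.mem_Icc.1 hv).1
    rw [Finset.card_product, Finset.card_product, Nat.filter_coprime_Ico_eq_totient]
    simp only [Nat.card_Icc]
    have hq : (M : ℝ) / v ≤ ((M / v + 1 : ℕ) : ℝ) := by
      rw [div_le_iff₀ (by positivity)]
      have := (Nat.lt_mul_div_succ M hv1).le
      rw [mul_comm] at this
      exact_mod_cast this
    generalize M / v + 1 = q at *
    have hq2 : q * q ≤ (q + 1 - 1) * (4 * q + 1 - 3 * q) := by
      apply Nat.mul_le_mul <;> omega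
    calc (M : ℝ) ^ 2 * (v.totient / (v : ℝ) ^ 2) = v.totient * (M / v : ℝ) ^ 2 := by ring
      _ ≤ v.totient * (q : ℝ) ^ 2 := by gcongr
      _ = ((v.totient * (q * q) : ℕ) : ℝ) := by push_cast; ring
      _ ≤ _ := by exact_mod_cast Nat.mul_le_mul_left _ hq2
  have h1 := log_le_two_mul_sum_totient_div_sq M
  have h2 : ((quadrupleParams M).card : ℝ) ≤ (squareQuadruples (Finset.Ico M (18 * M))).card := by
    exact_mod_cast card_quadrupleParams_le M
  nlinarith [mul_le_mul_of_nonneg_left h1 (sq_nonneg (M : ℝ))]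

lemma exists_factorization_of_mul_eq_mul {p q r s : ℕ} (hp : 0 < p) (h : p * q = r * s) :
    ∃ u v w z, p = u * v ∧ q = w * z ∧ r = u * w ∧ s = v * z := by
  have hg : 0 < Nat.gcd p r := Nat.gcd_pos_of_pos_left _ hp
  obtain ⟨v, w, hco, hv, hw⟩ := Nat.exists_coprime p r
  generalize Nat.gcd p r = u at *
  subst hv hw
  have h' : v * q = w * s := by
    apply Nat.eq_of_mul_eq_mul_left hg
    linarith
  obtain ⟨z, rfl⟩ : w ∣ q := hco.symm.dvd_of_dvd_mul_left ⟨s, h'⟩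
  have hw0 : 0 < w ∨ w = 0 := by omega
  rcases hw0 with hw0 | rfl
  · refine ⟨u, v, w, z, by ring, rfl, by ring, ?_⟩
    apply Nat.eq_of_mul_eq_mul_left hw0
    linarith
  · have hv1 : v = 1 := by simpa using hco
    subst hv1
    exact ⟨u, 1, 0, s, by ring, by ring, by ring, by ring⟩

/-- Parameters `(u, z, v, w)` all of whose products `uv, uw, zv, zw` are at most `X`. -/
def productParams (X : ℕ) : Finset (Σ _ : ℕ × ℕ, ℕ × ℕ) :=
  (Finset.Icc 1 X ×ˢ Finset.Icc 1 X).sigma fun p =>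
    Finset.Icc 1 (X / max p.1 p.2) ×ˢ Finset.Icc 1 (X / max p.1 p.2)

lemma sum_inv_max_sq_le (X : ℕ) :
    ∑ p ∈ Finset.Icc 1 X ×ˢ Finset.Icc 1 X, (((max p.1 p.2 : ℕ) : ℝ) ^ 2)⁻¹ ≤
      2 * (1 + Real.log X) := by
  have hharm : ∑ u ∈ Finset.Icc 1 X, ((u : ℝ))⁻¹ ≤ 1 + Real.log X := by
    have h := harmonic_le_one_add_log X
    rw [harmonic_eq_sum_Icc] at h
    simpa using h
  have hhalf : ∑ u ∈ Finset.Icc 1 X, ∑ z ∈ Finset.Icc 1 X,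
      (if z ≤ u then ((u : ℝ) ^ 2)⁻¹ else 0) ≤ 1 + Real.log X := by
    refine le_trans (Finset.sum_le_sum fun u hu => ?_) hharm
    have hu1 := (Finset.mem_Icc.1 hu).1
    rw [← Finset.sum_filter, Finset.sum_const, nsmul_eq_mul]
    have hc : ({z ∈ Finset.Icc 1 X | z ≤ u}).card ≤ u := by
      calc _ ≤ (Finset.Icc 1 u).card := Finset.card_le_card fun z hz => by
            simp only [Finset.mem_filter, Finset.mem_Icc] at hz ⊢; omega
        _ = u := by simp
    have hu0 : (0 : ℝ) < u := by exact_mod_cast hu1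
    calc _ ≤ (u : ℝ) * ((u : ℝ) ^ 2)⁻¹ := by gcongr
      _ = _ := by field_simp
  calc _ ≤ ∑ p ∈ Finset.Icc 1 X ×ˢ Finset.Icc 1 X,
        ((if p.2 ≤ p.1 then ((p.1 : ℝ) ^ 2)⁻¹ else 0) +
          (if p.1 ≤ p.2 then ((p.2 : ℝ) ^ 2)⁻¹ else 0)) := by
        refine Finset.sum_le_sum fun p _ => ?_
        rcases le_total p.1 p.2 with h | h
        · rw [max_eq_right h, if_pos h]
          have : (0 : ℝ) ≤ if p.2 ≤ p.1 then ((p.1 : ℝ) ^ 2)⁻¹ else 0 := by positivity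
          linarith
        · rw [max_eq_left h, if_pos h]
          have : (0 : ℝ) ≤ if p.1 ≤ p.2 then ((p.2 : ℝ) ^ 2)⁻¹ else 0 := by positivity
          linarith
    _ = 2 * ∑ u ∈ Finset.Icc 1 X, ∑ z ∈ Finset.Icc 1 X,
          (if z ≤ u then ((u : ℝ) ^ 2)⁻¹ else 0) := by
        rw [Finset.sum_add_distrib, Finset.sum_product, Finset.sum_product_right]
        ring
    _ ≤ _ := by linarith

lemma card_productParams_le (X : ℕ) :
    ((productParams X).card : ℝ) ≤ 2 * (X : ℝ) ^ 2 * (1 + Real.log X) := by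
  rw [productParams, Finset.card_sigma, Nat.cast_sum]
  calc _ ≤ ∑ p ∈ Finset.Icc 1 X ×ˢ Finset.Icc 1 X,
        (X : ℝ) ^ 2 * (((max p.1 p.2 : ℕ) : ℝ) ^ 2)⁻¹ := by
        refine Finset.sum_le_sum fun p _ => ?_
        rw [Finset.card_product, Nat.card_Icc, Nat.add_sub_cancel, Nat.cast_mul, ← sq,
          ← div_eq_mul_inv, ← div_pow]
        gcongr
        exact Nat.cast_div_le
    _ ≤ _ := by
        rw [← Finset.mul_sum]
        nlinarith [mul_le_mul_of_nonneg_left (sum_inv_max_sq_le X) (sq_nonneg (X : ℝ))]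

lemma card_filter_lt_squareQuadruples_le (K : ℕ) :
    ({p ∈ squareQuadruples (Finset.Ico K (2 * K)) | p.2.2.1 < p.1}).card ≤
      (productParams (4 * K)).card := by
  refine (Finset.card_le_card (t := (productParams (4 * K)).image fun p =>
    ((p.1.1 * p.2.1 + p.2.2 * p.1.2) / 2, (p.2.1 * p.1.2 - p.1.1 * p.2.2) / 2,
      (p.2.2 * p.1.2 - p.1.1 * p.2.1) / 2, (p.1.1 * p.2.2 + p.2.1 * p.1.2) / 2)) ?_).trans
    Finset.card_image_le
  rintro ⟨a, b, c, d⟩ hp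
  simp only [Finset.mem_filter, mem_squareQuadruples, Finset.mem_Ico] at hp
  obtain ⟨⟨⟨ha, hb, hc, hd⟩, heq⟩, hca⟩ := hp
  have hbd : b < d := by
    by_contra! h
    nlinarith
  have hmul : (a - c) * (a + c) = (d - b) * (d + b) := by
    zify [hca.le, hbd.le]
    zify at heq
    linarith
  obtain ⟨u, v, w, z, h1, h2, h3, h4⟩ :=
    exists_factorization_of_mul_eq_mul (Nat.sub_pos_of_lt hca) hmul
  refine Finset.mem_image.2 ⟨⟨(u, z), (v, w)⟩, ?_, ?_⟩
  · have p1 : 0 < u * v := by omega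
    have p2 : 0 < w * z := by omega
    have hu : 0 < u := Nat.pos_of_mul_pos_right p1
    have hv : 0 < v := Nat.pos_of_mul_pos_left p1
    have hw : 0 < w := Nat.pos_of_mul_pos_right p2
    have hz : 0 < z := Nat.pos_of_mul_pos_left p2
    have hm : 0 < max u z := by omega
    have b1 : u * v ≤ 4 * K := by omega
    have b2 : w * z ≤ 4 * K := by omega
    have b3 : u * w ≤ 4 * K := by omega
    have b4 : v * z ≤ 4 * K := by omega
    have m1 : v * max u z ≤ 4 * K := by
      rcases max_choice u z with h | h <;> rw [h] <;> linarith
    have m2 : w * max u z ≤ 4 * K := by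
      rcases max_choice u z with h | h <;> rw [h] <;> linarith
    simp only [productParams, Finset.mem_sigma, Finset.mem_product, Finset.mem_Icc,
      Nat.le_div_iff_mul_le hm]
    refine ⟨⟨⟨hu, ?_⟩, hz, ?_⟩, ⟨hv, m1⟩, hw, m2⟩ <;> nlinarith
  · simp only [← h1, ← h2, ← h3, ← h4, Prod.mk.injEq]
    omega

lemma card_squareQuadruples_Ico_le {K : ℕ} (hK : 1 ≤ K) :
    ((squareQuadruples (Finset.Ico K (2 * K))).card : ℝ) ≤
      193 * ((K : ℝ) ^ 2 * (1 + Real.log K)) := by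
  set Q := squareQuadruples (Finset.Ico K (2 * K)) with hQ
  have hgt : ({p ∈ Q | p.1 < p.2.2.1}).card ≤ ({p ∈ Q | p.2.2.1 < p.1}).card := by
    refine Finset.card_le_card_of_injOn (fun p => (p.2.2.1, p.2.2.2, p.1, p.2.1)) ?_ ?_
    · rintro ⟨a, b, c, d⟩ hp
      simp only [hQ, Finset.coe_filter, Set.mem_ofPred_eq, mem_squareQuadruples] at hp ⊢
      tauto
    · rintro ⟨a, b, c, d⟩ _ ⟨a', b', c', d'⟩ _ h
      simp only [Prod.mk.injEq] at h ⊢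
      tauto
  have hdiag : ({p ∈ Q | p.1 = p.2.2.1}).card ≤ K ^ 2 := by
    calc _ ≤ (Finset.Ico K (2 * K) ×ˢ Finset.Ico K (2 * K)).card := by
          refine Finset.card_le_card_of_injOn (fun p => (p.1, p.2.1)) ?_ ?_
          · rintro ⟨a, b, c, d⟩ hp
            simp only [hQ, Finset.coe_filter, Set.mem_ofPred_eq, mem_squareQuadruples] at hp
            simp only [Finset.coe_product, Set.mem_prod, Finset.mem_coe]
            tauto
          · rintro ⟨a, b, c, d⟩ hp ⟨a', b', c', d'⟩ hp' h
            simp only [hQ, Finset.coe_filter, Set.mem_ofPred_eq, mem_squareQuadruples] at hp hp'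
            simp only [Prod.mk.injEq] at h ⊢
            obtain ⟨⟨_, e⟩, rfl⟩ := hp
            obtain ⟨⟨_, e'⟩, rfl⟩ := hp'
            obtain ⟨rfl, rfl⟩ := h
            refine ⟨rfl, rfl, rfl, ?_⟩
            exact Nat.pow_left_injective (n := 2) (by norm_num) (by dsimp only; omega)
      _ = K ^ 2 := by
          rw [Finset.card_product, Nat.card_Ico, sq]
          congr 1 <;> omega
  have hsplit : Q.card ≤ ({p ∈ Q | p.1 = p.2.2.1}).card +
      (({p ∈ Q | p.1 < p.2.2.1}).card + ({p ∈ Q | p.2.2.1 < p.1}).card) := by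
    refine le_trans (Finset.card_le_card ?_) ((Finset.card_union_le _ _).trans
      (Nat.add_le_add_left (Finset.card_union_le _ _) _))
    intro p hp
    simp only [Finset.mem_union, Finset.mem_filter]
    rcases lt_trichotomy p.1 p.2.2.1 with h | h | h <;> tauto
  have hlt : ({p ∈ Q | p.2.2.1 < p.1}).card ≤ (productParams (4 * K)).card :=
    card_filter_lt_squareQuadruples_le K
  have hnat : (Q.card : ℝ) ≤ (K : ℝ) ^ 2 + 2 * ((productParams (4 * K)).card : ℝ) := by
    have : Q.card ≤ K ^ 2 + 2 * (productParams (4 * K)).card := by omega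
    exact_mod_cast this
  have hpar := card_productParams_le (4 * K)
  have hK' : (1 : ℝ) ≤ K := by exact_mod_cast hK
  have hlog4 : Real.log ((4 * K : ℕ) : ℝ) ≤ 2 + Real.log K := by
    push_cast
    rw [Real.log_mul (by norm_num) (by positivity)]
    have h4 : Real.log 4 = 2 * Real.log 2 := by
      rw [show (4 : ℝ) = 2 ^ 2 by norm_num, Real.log_pow]; norm_num
    linarith [Real.log_two_lt_d9]
  have hlog : 0 ≤ Real.log K := Real.log_nonneg hK'
  have hK2 : 0 ≤ (K : ℝ) ^ 2 := sq_nonneg _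
  push_cast at hpar hlog4
  have := mul_le_mul_of_nonneg_left hlog4 hK2
  nlinarith [mul_nonneg hK2 hlog]

lemma norm_eChar (k : ℕ) (x : ℝ) : ‖eChar k x‖ = 1 := by
  have : 2 * (Real.pi : ℂ) * Complex.I * (k : ℂ) * (x : ℂ) =
      ((2 * Real.pi * k * x : ℝ) : ℂ) * Complex.I := by push_cast; ring
  rw [eChar, this, Complex.norm_exp_ofReal_mul_I]

lemma continuous_eChar (k : ℕ) : Continuous (eChar k) := by
  unfold eChar; fun_prop

lemma integral_exp_two_pi_int_mul (m : ℤ) :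
    ∫ x in (0 : ℝ)..1, Complex.exp (2 * Real.pi * Complex.I * (m : ℂ) * (x : ℂ)) =
      if m = 0 then 1 else 0 := by
  split_ifs with h
  · simp [h]
  · have hc : 2 * (Real.pi : ℂ) * Complex.I * (m : ℂ) ≠ 0 :=
      mul_ne_zero Complex.two_pi_I_ne_zero (by exact_mod_cast h)
    have h1 : 2 * (Real.pi : ℂ) * Complex.I * (m : ℂ) = m * (2 * Real.pi * Complex.I) := by ring
    rw [integral_exp_mul_complex hc, Complex.ofReal_one, mul_one, h1,
      Complex.exp_int_mul_two_pi_mul_I]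
    simp

lemma eChar_mul_mul_conj_mul_conj (k l m n : ℕ) (x : ℝ) :
    eChar k x * eChar l x * (starRingEnd ℂ) (eChar m x) * (starRingEnd ℂ) (eChar n x) =
      Complex.exp (2 * Real.pi * Complex.I * (((k : ℤ) + l - m - n : ℤ) : ℂ) * (x : ℂ)) := by
  simp only [eChar, ← Complex.exp_conj, ← Complex.exp_add]
  congr 1
  simp only [map_mul, Complex.conj_ofReal, Complex.conj_I, map_natCast, map_ofNat]
  push_cast
  ring

/-- The trigonometric polynomial `∑_{n ∈ S} e^{2πin²x}/n²`. -/
noncomputable def squarePoly (S : Finset ℕ) (x : ℝ) : ℂ :=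
  ∑ n ∈ S, ((((n : ℝ) ^ 2)⁻¹ : ℝ) : ℂ) * eChar (n ^ 2) x

lemma continuous_squarePoly (S : Finset ℕ) : Continuous (squarePoly S) := by
  unfold squarePoly
  exact continuous_finsetSum _ fun n _ => continuous_const.mul (continuous_eChar _)

lemma integral_norm_squarePoly_pow_four (S : Finset ℕ) :
    ∫ x in (0 : ℝ)..1, ‖squarePoly S x‖ ^ 4 =
      ∑ p ∈ squareQuadruples S, (((p.1 : ℝ) * p.2.1 * p.2.2.1 * p.2.2.2) ^ 2)⁻¹ := by
  have hpt : ∀ x : ℝ, ((‖squarePoly S x‖ ^ 4 : ℝ) : ℂ) =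
      ∑ p ∈ S ×ˢ S ×ˢ S ×ˢ S,
        (((((p.1 : ℝ) * p.2.1 * p.2.2.1 * p.2.2.2) ^ 2)⁻¹ : ℝ) : ℂ) *
        Complex.exp (2 * Real.pi * Complex.I *
          ((((p.1 ^ 2 : ℕ) : ℤ) + (p.2.1 ^ 2 : ℕ) - (p.2.2.1 ^ 2 : ℕ) - (p.2.2.2 ^ 2 : ℕ) : ℤ) : ℂ)
            * (x : ℂ)) := by
    intro x
    have h1 : ((‖squarePoly S x‖ ^ 4 : ℝ) : ℂ) = squarePoly S x * (squarePoly S x *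
        ((starRingEnd ℂ) (squarePoly S x) * (starRingEnd ℂ) (squarePoly S x))) := by
      have := Complex.mul_conj' (squarePoly S x)
      push_cast
      linear_combination
        (-(‖squarePoly S x‖ : ℂ) ^ 2 - squarePoly S x * (starRingEnd ℂ) (squarePoly S x)) * this
    have h2 : (starRingEnd ℂ) (squarePoly S x) =
        ∑ n ∈ S, ((((n : ℝ) ^ 2)⁻¹ : ℝ) : ℂ) * (starRingEnd ℂ) (eChar (n ^ 2) x) := by
      simp only [squarePoly, map_sum, map_mul, Complex.conj_ofReal]
    rw [h1, h2, squarePoly]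
    simp only [Finset.sum_product]
    rw [Finset.sum_mul]
    refine Finset.sum_congr rfl fun a _ => ?_
    rw [Finset.sum_mul, Finset.mul_sum]
    refine Finset.sum_congr rfl fun b _ => ?_
    rw [Finset.sum_mul, Finset.mul_sum, Finset.mul_sum]
    refine Finset.sum_congr rfl fun c _ => ?_
    rw [Finset.mul_sum, Finset.mul_sum, Finset.mul_sum]
    refine Finset.sum_congr rfl fun d _ => ?_
    rw [← eChar_mul_mul_conj_mul_conj]
    push_cast
    simp only [mul_pow, mul_inv]
    ring
  have hC : ((∫ x in (0 : ℝ)..1, ‖squarePoly S x‖ ^ 4 : ℝ) : ℂ) =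
      ((∑ p ∈ squareQuadruples S, (((p.1 : ℝ) * p.2.1 * p.2.2.1 * p.2.2.2) ^ 2)⁻¹ : ℝ) : ℂ) := by
    rw [← intervalIntegral.integral_ofReal]
    simp only [hpt]
    rw [intervalIntegral.integral_finsetSum]
    · simp only [intervalIntegral.integral_const_mul, integral_exp_two_pi_int_mul]
      rw [squareQuadruples, Finset.sum_filter, Complex.ofReal_sum]
      refine Finset.sum_congr rfl fun p _ => ?_
      have hiff : (((p.1 ^ 2 : ℕ) : ℤ) + (p.2.1 ^ 2 : ℕ) - (p.2.2.1 ^ 2 : ℕ) - (p.2.2.2 ^ 2 : ℕ)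
          = 0) ↔ p.1 ^ 2 + p.2.1 ^ 2 = p.2.2.1 ^ 2 + p.2.2.2 ^ 2 := by
        generalize p.1 ^ 2 = a
        generalize p.2.1 ^ 2 = b
        generalize p.2.2.1 ^ 2 = c
        generalize p.2.2.2 ^ 2 = d
        omega
      simp only [hiff]
      split_ifs <;> simp
    · intro p _
      apply Continuous.intervalIntegrable
      fun_prop
  exact_mod_cast hC

lemma RiemannHigh_eq_tsum_of_forall_iff {N M : ℕ} (hM : ∀ n, N ≤ n ^ 2 ↔ M ≤ n) (x : ℝ) :
    RiemannHigh N x = ∑' n : ℕ,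
      if M ≤ n then ((((n : ℝ) ^ 2)⁻¹ : ℝ) : ℂ) * eChar (n ^ 2) x else 0 := by
  have hinj : Function.Injective fun n : ℕ => n ^ 2 := Nat.pow_left_injective (by norm_num)
  rw [RiemannHigh, ← hinj.tsum_eq]
  · refine tsum_congr fun n => ?_
    have : IsSquare (n ^ 2) := ⟨n, sq n⟩
    simp only [hM, sqIndicator, this, if_true]
    push_cast
    simp [one_div]
  · intro k hk
    by_contra hns
    have : ¬ IsSquare k := by
      rintro ⟨n, rfl⟩
      exact hns ⟨n, sq n⟩
    exact hk (by simp [sqIndicator, this])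

lemma tendsto_squarePoly_Ico {N M : ℕ} (hM : ∀ n, N ≤ n ^ 2 ↔ M ≤ n) (x : ℝ) :
    Filter.Tendsto (fun L => squarePoly (Finset.Ico M L) x) Filter.atTop
      (nhds (RiemannHigh N x)) := by
  rw [RiemannHigh_eq_tsum_of_forall_iff hM]
  have hsum : Summable fun n : ℕ =>
      if M ≤ n then ((((n : ℝ) ^ 2)⁻¹ : ℝ) : ℂ) * eChar (n ^ 2) x else 0 := by
    refine Summable.of_norm_bounded (g := fun n : ℕ => ((n : ℝ) ^ 2)⁻¹)
      (Real.summable_nat_pow_inv.2 (by norm_num)) fun n => ?_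
    split_ifs
    · rw [norm_mul, norm_eChar, mul_one, Complex.norm_real, Real.norm_of_nonneg (by positivity)]
    · simp only [norm_zero]; positivity
  convert hsum.hasSum.tendsto_sum_nat using 2 with L
  rw [← Finset.sum_filter, squarePoly]
  congr 1
  ext n
  simp only [Finset.mem_Ico, Finset.mem_filter, Finset.mem_range]
  tauto

lemma norm_squarePoly_le_two {M : ℕ} (hM : 1 ≤ M) (L : ℕ) (x : ℝ) :
    ‖squarePoly (Finset.Ico M L) x‖ ≤ 2 := by
  refine (norm_sum_le _ _).trans (le_trans ?_ (sum_Icc_inv_sq_le_two L))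
  calc _ = ∑ n ∈ Finset.Ico M L, ((n : ℝ) ^ 2)⁻¹ := by
        refine Finset.sum_congr rfl fun n _ => ?_
        rw [norm_mul, norm_eChar, mul_one, Complex.norm_real, Real.norm_of_nonneg (by positivity)]
    _ ≤ _ := by
        refine Finset.sum_le_sum_of_subset_of_nonneg (fun n hn => ?_) fun _ _ _ => by positivity
        simp only [Finset.mem_Ico, Finset.mem_Icc] at hn ⊢
        omega

lemma tendsto_integral_squarePoly_Ico {N M : ℕ} (hM1 : 1 ≤ M) (hM : ∀ n, N ≤ n ^ 2 ↔ M ≤ n) :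
    Filter.Tendsto (fun L => ∫ x in (0 : ℝ)..1, ‖squarePoly (Finset.Ico M L) x‖ ^ 4)
      Filter.atTop (nhds (∫ x in (0 : ℝ)..1, ‖RiemannHigh N x‖ ^ 4)) := by
  refine intervalIntegral.tendsto_integral_filter_of_dominated_convergence (fun _ => 2 ^ 4)
    ?_ ?_ intervalIntegrable_const ?_
  · exact Filter.Eventually.of_forall fun L =>
      ((continuous_squarePoly _).norm.pow 4).aestronglyMeasurable
  · refine Filter.Eventually.of_forall fun L => Filter.Eventually.of_forall fun x _ => ?_
    rw [Real.norm_of_nonneg (by positivity)]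
    gcongr
    exact norm_squarePoly_le_two hM1 L x
  · exact Filter.Eventually.of_forall fun x _ => (tendsto_squarePoly_Ico hM x).norm.pow 4

lemma integral_norm_squarePoly_dyadic_block_le {K : ℕ} (hK : 1 ≤ K) :
    ∫ x in (0 : ℝ)..1, ‖squarePoly (Finset.Ico K (2 * K)) x‖ ^ 4 ≤
      193 * ((1 + Real.log K) / (K : ℝ) ^ 6) := by
  have hK' : (0 : ℝ) < K := by exact_mod_cast hK
  rw [integral_norm_squarePoly_pow_four]
  calc _ ≤ ∑ _p ∈ squareQuadruples (Finset.Ico K (2 * K)), ((K : ℝ) ^ 8)⁻¹ := by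
        refine Finset.sum_le_sum ?_
        rintro ⟨a, b, c, d⟩ hp
        simp only [mem_squareQuadruples, Finset.mem_Ico] at hp
        obtain ⟨⟨ha, hb, hc, hd⟩, -⟩ := hp
        have h1 : (K : ℝ) ≤ a := by exact_mod_cast ha.1
        have h2 : (K : ℝ) ≤ b := by exact_mod_cast hb.1
        have h3 : (K : ℝ) ≤ c := by exact_mod_cast hc.1
        have h4 : (K : ℝ) ≤ d := by exact_mod_cast hd.1
        calc _ ≤ (((K : ℝ) * K * K * K) ^ 2)⁻¹ := by dsimp only; gcongr
          _ = _ := by congr 1; ring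
    _ ≤ 193 * ((K : ℝ) ^ 2 * (1 + Real.log K)) * ((K : ℝ) ^ 8)⁻¹ := by
        rw [Finset.sum_const, nsmul_eq_mul]
        gcongr
        exact card_squareQuadruples_Ico_le hK
    _ = _ := by field_simp

lemma integral_norm_squarePoly_Ico_two_pow_le (J : ℕ) {M : ℕ} (hM : 1 ≤ M) :
    ∫ x in (0 : ℝ)..1, ‖squarePoly (Finset.Ico M (2 ^ J * M)) x‖ ^ 4 ≤
      3088 * ((1 + Real.log M) / (M : ℝ) ^ 6) := by
  induction J generalizing M with
  | zero =>
    have : 0 ≤ Real.log M := Real.log_natCast_nonneg M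
    simp only [pow_zero, one_mul, Finset.Ico_self, squarePoly, Finset.sum_empty, norm_zero]
    simp only [ne_eq, OfNat.ofNat_ne_zero, not_false_eq_true, zero_pow,
      intervalIntegral.integral_zero]
    positivity
  | succ J ih =>
    have hsplit : ∀ x, squarePoly (Finset.Ico M (2 ^ (J + 1) * M)) x =
        squarePoly (Finset.Ico M (2 * M)) x +
          squarePoly (Finset.Ico (2 * M) (2 ^ J * (2 * M))) x := by
      intro x
      have h2 : 2 ^ (J + 1) * M = 2 ^ J * (2 * M) := by ring
      rw [h2, squarePoly, squarePoly, squarePoly, Finset.sum_Ico_consecutive _ (by omega)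
        (Nat.le_mul_of_pos_left _ (by positivity))]
    have hint : ∀ S, IntervalIntegrable (fun x => ‖squarePoly S x‖ ^ 4) volume 0 1 :=
      fun S => ((continuous_squarePoly S).norm.pow 4).intervalIntegrable _ _
    have hM' : (0 : ℝ) < M := by exact_mod_cast hM
    have hlog : 0 ≤ Real.log M := Real.log_natCast_nonneg M
    have h1 := integral_norm_squarePoly_dyadic_block_le hM
    have h2 := ih (M := 2 * M) (by omega)
    calc _ ≤ ∫ x in (0 : ℝ)..1, (8 * ‖squarePoly (Finset.Ico M (2 * M)) x‖ ^ 4 +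
          8 * ‖squarePoly (Finset.Ico (2 * M) (2 ^ J * (2 * M))) x‖ ^ 4) := by
          refine intervalIntegral.integral_mono_on (by norm_num) (hint _)
            (((hint _).const_mul _).add ((hint _).const_mul _)) fun x _ => ?_
          rw [hsplit]
          calc _ ≤ (‖squarePoly (Finset.Ico M (2 * M)) x‖ +
                ‖squarePoly (Finset.Ico (2 * M) (2 ^ J * (2 * M))) x‖) ^ 4 := by
                gcongr; exact norm_add_le _ _
            _ ≤ _ := (add_pow_le (norm_nonneg _) (norm_nonneg _) 4).trans (by norm_num [mul_add])
      _ = 8 * (∫ x in (0 : ℝ)..1, ‖squarePoly (Finset.Ico M (2 * M)) x‖ ^ 4) +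
          8 * ∫ x in (0 : ℝ)..1, ‖squarePoly (Finset.Ico (2 * M) (2 ^ J * (2 * M))) x‖ ^ 4 := by
          rw [intervalIntegral.integral_add ((hint _).const_mul _) ((hint _).const_mul _),
            intervalIntegral.integral_const_mul, intervalIntegral.integral_const_mul]
      _ ≤ 8 * (193 * ((1 + Real.log M) / (M : ℝ) ^ 6)) +
          8 * (3088 * ((1 + Real.log (2 * M : ℕ)) / ((2 * M : ℕ) : ℝ) ^ 6)) := by gcongr
      _ ≤ 8 * (193 * ((1 + Real.log M) / (M : ℝ) ^ 6)) +
          8 * (3088 * ((2 * (1 + Real.log M)) / ((2 * M : ℕ) : ℝ) ^ 6)) := by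
          gcongr
          push_cast
          rw [Real.log_mul (by norm_num) hM'.ne']
          linarith [Real.log_two_lt_d9]
      _ = 2316 * ((1 + Real.log M) / (M : ℝ) ^ 6) := by
          push_cast
          field_simp
          norm_num
      _ ≤ _ := by gcongr; norm_num

lemma log_div_pow_six_le_integral_norm_squarePoly {M L : ℕ} (hM : 1 ≤ M) (hL : 18 * M ≤ L) :
    Real.log M / (M : ℝ) ^ 6 / (2 * 18 ^ 8) ≤
      ∫ x in (0 : ℝ)..1, ‖squarePoly (Finset.Ico M L) x‖ ^ 4 := by
  have hM' : (0 : ℝ) < M := by exact_mod_cast hM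
  rw [integral_norm_squarePoly_pow_four]
  calc Real.log M / (M : ℝ) ^ 6 / (2 * 18 ^ 8)
      = (M : ℝ) ^ 2 * Real.log M / 2 * ((18 * (M : ℝ)) ^ 8)⁻¹ := by field_simp
    _ ≤ ((squareQuadruples (Finset.Ico M (18 * M))).card : ℝ) * ((18 * (M : ℝ)) ^ 8)⁻¹ := by
        gcongr
        linarith [sq_mul_log_le_card_squareQuadruples M]
    _ = ∑ _p ∈ squareQuadruples (Finset.Ico M (18 * M)), ((18 * (M : ℝ)) ^ 8)⁻¹ := by
        rw [Finset.sum_const, nsmul_eq_mul]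
    _ ≤ ∑ p ∈ squareQuadruples (Finset.Ico M (18 * M)),
          (((p.1 : ℝ) * p.2.1 * p.2.2.1 * p.2.2.2) ^ 2)⁻¹ := by
        refine Finset.sum_le_sum ?_
        rintro ⟨a, b, c, d⟩ hp
        simp only [mem_squareQuadruples, Finset.mem_Ico] at hp
        obtain ⟨⟨ha, hb, hc, hd⟩, -⟩ := hp
        have ha0 : (0 : ℝ) < a := by exact_mod_cast (by omega : 0 < a)
        have hb0 : (0 : ℝ) < b := by exact_mod_cast (by omega : 0 < b)
        have hc0 : (0 : ℝ) < c := by exact_mod_cast (by omega : 0 < c)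
        have hd0 : (0 : ℝ) < d := by exact_mod_cast (by omega : 0 < d)
        have h1 : (a : ℝ) ≤ 18 * M := by exact_mod_cast ha.2.le
        have h2 : (b : ℝ) ≤ 18 * M := by exact_mod_cast hb.2.le
        have h3 : (c : ℝ) ≤ 18 * M := by exact_mod_cast hc.2.le
        have h4 : (d : ℝ) ≤ 18 * M := by exact_mod_cast hd.2.le
        calc ((18 * (M : ℝ)) ^ 8)⁻¹
            = (((18 * (M : ℝ)) * (18 * M) * (18 * M) * (18 * M)) ^ 2)⁻¹ := by congr 1; ring
          _ ≤ _ := by dsimp only; gcongr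
    _ ≤ _ := by
        refine Finset.sum_le_sum_of_subset_of_nonneg ?_ fun _ _ _ => by positivity
        rintro ⟨a, b, c, d⟩ hp
        simp only [mem_squareQuadruples, Finset.mem_Ico] at hp ⊢
        omega

/-- There exist `c, C > 0` and `N₀ ∈ ℕ` such that for every integer `N ≥ N₀`,
`c · N^{-3} · log N ≤ ‖R_{≥N}‖_{L⁴(𝕋)}⁴ ≤ C · N^{-3} · log N`. -/
theorem riemann_highpass_L4_pow_four :
    ∃ c C : ℝ, 0 < c ∧ 0 < C ∧ ∃ N₀ : ℕ, ∀ N : ℕ, N₀ ≤ N →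
      c * (N : ℝ) ^ (-(3 : ℝ)) * Real.log N ≤
        (∫ x in (0:ℝ)..1, ‖RiemannHigh N x‖ ^ 4) ∧
      (∫ x in (0:ℝ)..1, ‖RiemannHigh N x‖ ^ 4) ≤
        C * (N : ℝ) ^ (-(3 : ℝ)) * Real.log N := by
  refine ⟨1 / (32 * 18 ^ 8), 6176, by norm_num, by norm_num, 3, fun N hN => ?_⟩
  obtain ⟨M, hM1, hM, hMN, hM2, hN2⟩ : ∃ M : ℕ, 1 ≤ M ∧ (∀ n, N ≤ n ^ 2 ↔ M ≤ n) ∧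
      M ≤ N ∧ M ^ 2 ≤ 2 * N ∧ N ≤ M ^ 2 := by
    have hiff : ∀ n, N ≤ n ^ 2 ↔ Nat.sqrt (N - 1) + 1 ≤ n := fun n => by
      rw [Nat.succ_le_iff, Nat.sqrt_lt']
      omega
    refine ⟨Nat.sqrt (N - 1) + 1, by omega, hiff, (hiff N).1 (by nlinarith), ?_,
      (hiff _).2 le_rfl⟩
    have h := Nat.sqrt_le' (N - 1)
    generalize Nat.sqrt (N - 1) = s at *
    have h' : s ^ 2 + 1 ≤ N := by omega
    zify at h' ⊢
    nlinarith [sq_nonneg ((s : ℤ) - 1)]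
  have hlim := tendsto_integral_squarePoly_Ico hM1 hM
  have hN0 : (3 : ℝ) ≤ N := by exact_mod_cast hN
  have hM0 : (1 : ℝ) ≤ M := by exact_mod_cast hM1
  have hMN' : (M : ℝ) ≤ N := by exact_mod_cast hMN
  have hM2' : (M : ℝ) ^ 2 ≤ 2 * N := by exact_mod_cast hM2
  have hN2' : (N : ℝ) ≤ (M : ℝ) ^ 2 := by exact_mod_cast hN2
  have hpow : (N : ℝ) ^ (-(3 : ℝ)) = ((N : ℝ) ^ 3)⁻¹ := by
    rw [Real.rpow_neg (by positivity)]
    norm_cast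
  have hlogN : 1 ≤ Real.log N := by
    rw [Real.le_log_iff_exp_le (by positivity)]
    linarith [Real.exp_one_lt_d9]
  have hlogM : Real.log M ≤ Real.log N := Real.log_le_log (by positivity) hMN'
  have hlogM' : Real.log N ≤ 2 * Real.log M := by
    have := Real.log_le_log (by positivity) hN2'
    rwa [Real.log_pow, Nat.cast_ofNat] at this
  have hN3 : (N : ℝ) ^ 3 ≤ (M : ℝ) ^ 6 := by
    calc (N : ℝ) ^ 3 ≤ ((M : ℝ) ^ 2) ^ 3 := by gcongr
      _ = _ := by ring
  have hM6 : (M : ℝ) ^ 6 ≤ 8 * (N : ℝ) ^ 3 := by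
    calc (M : ℝ) ^ 6 = ((M : ℝ) ^ 2) ^ 3 := by ring
      _ ≤ (2 * (N : ℝ)) ^ 3 := by gcongr
      _ = _ := by ring
  rw [hpow]
  constructor
  · refine le_trans ?_ (ge_of_tendsto hlim ((Filter.eventually_ge_atTop (18 * M)).mono
      fun L hL => log_div_pow_six_le_integral_norm_squarePoly hM1 hL))
    calc 1 / (32 * 18 ^ 8) * ((N : ℝ) ^ 3)⁻¹ * Real.log N
        = (Real.log N / 2) / (8 * (N : ℝ) ^ 3) / (2 * 18 ^ 8) := by field_simp; norm_num
      _ ≤ Real.log M / (M : ℝ) ^ 6 / (2 * 18 ^ 8) := by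
          gcongr
          linarith
  · have hdyadic : Filter.Tendsto (fun J : ℕ => 2 ^ J * M) Filter.atTop Filter.atTop :=
      (tendsto_pow_atTop_atTop_of_one_lt (by norm_num)).atTop_mul_const' hM1
    refine (le_of_tendsto' (hlim.comp hdyadic)
      fun J => integral_norm_squarePoly_Ico_two_pow_le J hM1).trans ?_
    calc 3088 * ((1 + Real.log M) / (M : ℝ) ^ 6)
        ≤ 3088 * ((2 * Real.log N) / (N : ℝ) ^ 3) := by
          gcongr
          linarith
      _ = _ := by ring
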